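/- Suppose f is (L₀,L₁)-smooth and bounded below by f*, β ∈ [0,1), and η ≤ (1−β)²/(L₁√d). Then for the AdaGrad-with-momentum iterates, for any T ≥ 1: Σ_{t=1}^T (f(x_t) − f*) ≤ (f(x₁) − f*)·T + (η√d/(1−β))·Σ_{t=1}^T Σ_{s=1}^t (‖∇f(x₁)‖ + (η√d/(1−β))·Σ_{j=1}^s 𝓛_j) + (η²d/(2(1−β)²))·Σ_{t=1}^T Σ_{s=1}^t 𝓛_s. -/

import Mathlib

open MeasureTheory Finset Real

section GeneralizedSmoothness

variable {E : Type*} [NormedAddCommGroup E] [InnerProductSpace ℝ E] [CompleteSpace E]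
  {f : E → ℝ} {f' : E → E} {L₀ L₁ : ℝ}

/-- The descent lemma for an `(L₀, L₁)`-smooth function. -/
theorem descent_of_generalized_smooth (hf : ∀ p, HasGradientAt f (f' p) p)
    (hL : ∀ p q, ‖p - q‖ ≤ 1 / L₁ → ‖f' q - f' p‖ ≤ (L₀ + L₁ * ‖f' p‖) * ‖p - q‖)
    (p u : E) (hu : ‖u‖ ≤ 1 / L₁) :
    f (p + u) ≤ f p + inner ℝ (f' p) u + (L₀ + L₁ * ‖f' p‖) / 2 * ‖u‖ ^ 2 := by
  set K := L₀ + L₁ * ‖f' p‖ with hK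
  have hline (t : ℝ) : HasDerivAt (fun t : ℝ => p + t • u) u t := by
    simpa using ((hasDerivAt_id t).smul_const u).const_add p
  have hφ (t : ℝ) : HasDerivAt
      (fun t : ℝ => f (p + t • u) - t * inner ℝ (f' p) u - K / 2 * ‖u‖ ^ 2 * t ^ 2)
      (inner ℝ (f' (p + t • u)) u - inner ℝ (f' p) u - K * ‖u‖ ^ 2 * t) t := by
    have h1 := (hf (p + t • u)).hasFDerivAt.comp_hasDerivAt t (hline t)
    have h2 := (hasDerivAt_id t).mul_const (inner ℝ (f' p) u)
    have h3 := (hasDerivAt_pow 2 t).const_mul (K / 2 * ‖u‖ ^ 2)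
    refine ((h1.sub h2).sub h3).congr_deriv ?_
    simp
    ring
  have hanti : AntitoneOn
      (fun t : ℝ => f (p + t • u) - t * inner ℝ (f' p) u - K / 2 * ‖u‖ ^ 2 * t ^ 2)
      (Set.Icc 0 1) := by
    refine antitoneOn_of_deriv_nonpos (convex_Icc 0 1)
      (fun t _ => (hφ t).continuousAt.continuousWithinAt)
      (fun t _ => (hφ t).differentiableAt.differentiableWithinAt) fun t ht => ?_
    rw [interior_Icc] at ht
    rw [(hφ t).deriv, ← inner_sub_left]
    have hnorm : ‖p - (p + t • u)‖ = t * ‖u‖ := by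
      rw [sub_add_cancel_left, norm_neg, norm_smul, Real.norm_of_nonneg ht.1.le]
    have hle : t * ‖u‖ ≤ 1 / L₁ :=
      (mul_le_of_le_one_left (norm_nonneg u) ht.2.le).trans hu
    have hdiff := hL p (p + t • u) (hnorm ▸ hle)
    rw [hnorm] at hdiff
    have hinner := real_inner_le_norm (f' (p + t • u) - f' p) u
    have := mul_le_mul_of_nonneg_right hdiff (norm_nonneg u)
    nlinarith
  have h := hanti (Set.left_mem_Icc.2 zero_le_one) (Set.right_mem_Icc.2 zero_le_one) zero_le_one
  simp only [one_smul, zero_smul, add_zero] at h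
  linarith

/-- The gradient of an `(L₀, L₁)`-smooth function is controlled by its suboptimality gap. -/
theorem norm_gradient_le_of_generalized_smooth (hf : ∀ p, HasGradientAt f (f' p) p)
    (hL₀ : 0 < L₀) (hL₁ : 0 < L₁)
    (hL : ∀ p q, ‖p - q‖ ≤ 1 / L₁ → ‖f' q - f' p‖ ≤ (L₀ + L₁ * ‖f' p‖) * ‖p - q‖)
    {c : ℝ} (hc : ∀ p, c ≤ f p) (p : E) :
    ‖f' p‖ ≤ 4 * L₁ * (f p - c) + √(4 * L₀ * (f p - c)) := by
  have hG := norm_nonneg (f' p)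
  have hΔ : 0 ≤ f p - c := sub_nonneg.2 (hc p)
  set K := L₀ + L₁ * ‖f' p‖ with hK
  have hKpos : 0 < K := by positivity
  have hnorm : ‖-(K⁻¹ • f' p)‖ = K⁻¹ * ‖f' p‖ := by
    rw [norm_neg, norm_smul, Real.norm_of_nonneg (inv_pos.2 hKpos).le]
  have hstep : ‖-(K⁻¹ • f' p)‖ ≤ 1 / L₁ := by
    rw [hnorm, inv_mul_eq_div, div_le_div_iff₀ hKpos hL₁]
    linarith
  have hdesc := descent_of_generalized_smooth hf hL p _ hstep
  rw [hnorm, inner_neg_right, real_inner_smul_right, real_inner_self_eq_norm_sq, ← hK] at hdesc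
  have hdecr : K⁻¹ * ‖f' p‖ ^ 2 / 2 ≤ f p - c := by
    have hsimp : K / 2 * (K⁻¹ * ‖f' p‖) ^ 2 = K⁻¹ * ‖f' p‖ ^ 2 / 2 := by field_simp
    linarith [hc (p + -(K⁻¹ • f' p))]
  have hsq : ‖f' p‖ ^ 2 ≤ 2 * K * (f p - c) := by
    calc ‖f' p‖ ^ 2 = 2 * K * (K⁻¹ * ‖f' p‖ ^ 2 / 2) := by field_simp
      _ ≤ _ := by gcongr
  rcases le_total L₀ (L₁ * ‖f' p‖) with h | h
  · have hlin : ‖f' p‖ ≤ 4 * L₁ * (f p - c) := by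
      have hpos : 0 < ‖f' p‖ := pos_of_mul_pos_right (hL₀.trans_le h) hL₁.le
      refine le_of_mul_le_mul_right ?_ hpos
      have := mul_le_mul_of_nonneg_right h hΔ
      nlinarith
    linarith [Real.sqrt_nonneg (4 * L₀ * (f p - c))]
  · have hroot : ‖f' p‖ ≤ √(4 * L₀ * (f p - c)) := by
      refine Real.le_sqrt_of_sq_le ?_
      have := mul_le_mul_of_nonneg_right h hΔ
      nlinarith
    have : 0 ≤ 4 * L₁ * (f p - c) := by positivity
    linarith

end GeneralizedSmoothness

/-- A sequence with increments bounded by `b` is bounded by the partial sums of `b`. -/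
theorem le_add_sum_Icc_of_le_add {a b : ℕ → ℝ} (hb : ∀ s, 1 ≤ s → 0 ≤ b s)
    (hab : ∀ s, 1 ≤ s → a (s + 1) ≤ a s + b s) {t : ℕ} (ht : 1 ≤ t) :
    a t ≤ a 1 + ∑ s ∈ Icc 1 t, b s := by
  have h : a t ≤ a 1 + ∑ s ∈ Ico 1 t, b s := by
    induction t, ht using Nat.le_induction with
    | base => simp
    | succ t ht ih =>
      rw [Finset.sum_Ico_succ_top ht]
      linarith [hab t ht]
  have hsub := Finset.sum_le_sum_of_subset_of_nonneg (f := b) (Ico_subset_Icc_self (a := 1) (b := t))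
    fun s hs _ => hb s (Finset.mem_Icc.1 hs).1
  linarith

/-- A Euclidean norm is at most `√n` times a bound on the `n` coordinates. -/
theorem EuclideanSpace.norm_le_sqrt_card_mul {ι : Type*} [Fintype ι] {u : EuclideanSpace ℝ ι}
    {c : ℝ} (hc : 0 ≤ c) (hu : ∀ i, |u i| ≤ c) : ‖u‖ ≤ √(Fintype.card ι) * c := by
  rw [EuclideanSpace.norm_eq]
  refine Real.sqrt_le_iff.2 ⟨by positivity, ?_⟩
  rw [mul_pow, Real.sq_sqrt (Nat.cast_nonneg _), ← nsmul_eq_mul, ← Finset.card_univ]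
  exact Finset.sum_le_card_nsmul _ _ _ fun i _ => pow_le_pow_left₀ (norm_nonneg _) (hu i) 2

/-- Each coordinate of the AdaGrad momentum buffer is at most `η / (1 - β)` in absolute value. -/
theorem abs_adagrad_momentum_le {β η ε : ℝ} (hβ0 : 0 ≤ β) (hβ1 : β < 1) (hη : 0 < η)
    (hε : 0 < ε) {g v m : ℕ → ℝ} (hv0 : v 0 = 0) (hm0 : m 0 = 0)
    (hv : ∀ s, 1 ≤ s → v s = v (s - 1) + g s ^ 2)
    (hm : ∀ s, 1 ≤ s → m s = β * m (s - 1) - η * g s / (√(v s) + ε)) (s : ℕ) :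
    |m s| ≤ η / (1 - β) := by
  have hβ : 0 < 1 - β := sub_pos.2 hβ1
  have hvnn (s : ℕ) : 0 ≤ v s := by
    induction s with
    | zero => exact hv0.ge
    | succ s ih =>
      rw [hv (s + 1) (by omega), Nat.add_sub_cancel]
      positivity
  induction s with
  | zero =>
    rw [hm0, abs_zero]
    positivity
  | succ s ih =>
    have hden : 0 < √(v (s + 1)) + ε := by positivity
    have hg : |g (s + 1)| ≤ √(v (s + 1)) + ε := by
      have : |g (s + 1)| ≤ √(v (s + 1)) := by
        refine Real.abs_le_sqrt ?_
        rw [hv (s + 1) (by omega), Nat.add_sub_cancel]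
        linarith [hvnn s]
      linarith
    have hstep : |η * g (s + 1) / (√(v (s + 1)) + ε)| ≤ η := by
      rw [abs_div, abs_mul, abs_of_pos hη, abs_of_pos hden, div_le_iff₀ hden]
      gcongr
    rw [hm (s + 1) (by omega), Nat.add_sub_cancel]
    calc |β * m s - η * g (s + 1) / (√(v (s + 1)) + ε)|
        ≤ |β * m s| + |η * g (s + 1) / (√(v (s + 1)) + ε)| := abs_sub _ _
      _ ≤ β * (η / (1 - β)) + η := by
        rw [abs_mul, abs_of_nonneg hβ0]
        gcongr
      _ = η / (1 - β) := by
        field_simp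
        ring

theorem stmt_14
    {d : ℕ} (β η ε : ℝ) (hβ0 : 0 ≤ β) (hβ1 : β < 1) (hη : 0 < η) (hε : 0 < ε)
    (g v m x : ℕ → EuclideanSpace ℝ (Fin d))
    (hv0 : v 0 = 0) (hm0 : m 0 = 0) (hx0 : x 0 = x 1)
    (hv : ∀ s, 1 ≤ s → ∀ i, v s i = v (s - 1) i + g s i ^ 2)
    (hmrec : ∀ s, 1 ≤ s → ∀ i,
      m s i = β * m (s - 1) i - η * g s i / (Real.sqrt (v s i) + ε))
    (hxrec : ∀ s, 1 ≤ s → x (s + 1) = x s + m s)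
    (f : EuclideanSpace ℝ (Fin d) → ℝ) (fgrad : EuclideanSpace ℝ (Fin d) → EuclideanSpace ℝ (Fin d))
    (hgrad : ∀ p, HasGradientAt f (fgrad p) p)
    (L₀ L₁ : ℝ) (hL₀ : 0 < L₀) (hL₁ : 0 < L₁)
    (hgen : ∀ p q, ‖p - q‖ ≤ 1 / L₁ →
      ‖fgrad q - fgrad p‖ ≤ (L₀ + L₁ * ‖fgrad p‖) * ‖p - q‖)
    (fstar : ℝ) (hfstar : ∀ p, fstar ≤ f p)
    (hηgen : η ≤ (1 - β) ^ 2 / (L₁ * Real.sqrt (d : ℝ)))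
    (Ls : ℕ → ℝ)
    (hLs : ∀ s, Ls s = 2 * L₀ + 2 * L₁ *
      (4 * L₁ * (f (x s) - fstar) + Real.sqrt (4 * L₀ * (f (x s) - fstar))))
    (T : ℕ) (hT : 1 ≤ T) :
    ∑ t ∈ Finset.Icc 1 T, (f (x t) - fstar) ≤
      (f (x 1) - fstar) * (T : ℝ) +
      η * Real.sqrt (d : ℝ) / (1 - β) *
        ∑ t ∈ Finset.Icc 1 T, ∑ s ∈ Finset.Icc 1 t,
          (‖fgrad (x 1)‖ + η * Real.sqrt (d : ℝ) / (1 - β) * ∑ j ∈ Finset.Icc 1 s, Ls j) +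
      η ^ 2 * (d : ℝ) / (2 * (1 - β) ^ 2) *
        ∑ t ∈ Finset.Icc 1 T, ∑ s ∈ Finset.Icc 1 t, Ls s := by
  have hβ : 0 < 1 - β := sub_pos.2 hβ1
  set M := η * √(d : ℝ) / (1 - β) with hM
  have hM0 : 0 ≤ M := by positivity
  have hM2 : η ^ 2 * (d : ℝ) / (2 * (1 - β) ^ 2) = M ^ 2 / 2 := by
    rw [hM, div_pow, mul_pow, Real.sq_sqrt (Nat.cast_nonneg _)]
    field_simp
  have hd : 0 < √(d : ℝ) := by
    refine (Real.sqrt_nonneg _).lt_of_ne fun h => ?_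
    rw [← h, mul_zero, div_zero] at hηgen
    exact hη.not_ge hηgen
  have hML : M ≤ 1 / L₁ := by
    rw [le_div_iff₀ (by positivity)] at hηgen
    rw [hM, div_le_div_iff₀ hβ hL₁]
    nlinarith
  have hmM (s : ℕ) : ‖m s‖ ≤ M := by
    have h := EuclideanSpace.norm_le_sqrt_card_mul (by positivity : 0 ≤ η / (1 - β)) fun i =>
      abs_adagrad_momentum_le (g := fun s => g s i) (v := fun s => v s i) (m := fun s => m s i)
        hβ0 hβ1 hη hε (by simp [hv0]) (by simp [hm0]) (fun s hs => hv s hs i)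
        (fun s hs => hmrec s hs i) s
    rw [Fintype.card_fin] at h
    exact h.trans_eq (by rw [hM]; ring)
  have hKL (s : ℕ) : L₀ + L₁ * ‖fgrad (x s)‖ ≤ Ls s := by
    have h := norm_gradient_le_of_generalized_smooth hgrad hL₀ hL₁ hgen hfstar (x s)
    have h' := mul_le_mul_of_nonneg_left h hL₁.le
    have h'' : 0 ≤ L₁ * ‖fgrad (x s)‖ := by positivity
    rw [hLs]
    linarith
  have hK0 (s : ℕ) : 0 ≤ L₀ + L₁ * ‖fgrad (x s)‖ := by positivity
  have hLs0 (s : ℕ) : 0 ≤ Ls s := (hK0 s).trans (hKL s)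
  have hG {s : ℕ} (hs : 1 ≤ s) : ‖fgrad (x s)‖ ≤ ‖fgrad (x 1)‖ + M * ∑ j ∈ Icc 1 s, Ls j := by
    rw [Finset.mul_sum]
    refine le_add_sum_Icc_of_le_add (a := fun s => ‖fgrad (x s)‖)
      (fun j _ => mul_nonneg hM0 (hLs0 j)) (fun j hj => ?_) hs
    have hnorm : ‖x j - x (j + 1)‖ = ‖m j‖ := by
      rw [hxrec j hj, sub_add_cancel_left, norm_neg]
    have h := hgen (x j) (x (j + 1)) (hnorm ▸ (hmM j).trans hML)
    have h' : (L₀ + L₁ * ‖fgrad (x j)‖) * ‖m j‖ ≤ Ls j * M :=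
      mul_le_mul (hKL j) (hmM j) (norm_nonneg _) (hLs0 j)
    rw [hnorm] at h
    linarith [norm_le_norm_add_norm_sub' (fgrad (x (j + 1))) (fgrad (x j))]
  have hΔ {t : ℕ} (ht : 1 ≤ t) : f (x t) - fstar ≤ (f (x 1) - fstar) +
      ∑ s ∈ Icc 1 t, (M * (‖fgrad (x 1)‖ + M * ∑ j ∈ Icc 1 s, Ls j) + M ^ 2 / 2 * Ls s) := by
    refine le_add_sum_Icc_of_le_add (a := fun t => f (x t) - fstar) (fun s _ => ?_)
      (fun s hs => ?_) ht
    · have := Finset.sum_nonneg fun j (_ : j ∈ Icc 1 s) => hLs0 j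
      have := hLs0 s
      positivity
    · have h := descent_of_generalized_smooth hgrad hgen (x s) (m s) ((hmM s).trans hML)
      have hlin : inner ℝ (fgrad (x s)) (m s) ≤
          (‖fgrad (x 1)‖ + M * ∑ j ∈ Icc 1 s, Ls j) * M :=
        (real_inner_le_norm _ _).trans
          (mul_le_mul (hG hs) (hmM s) (norm_nonneg _) ((norm_nonneg _).trans (hG hs)))
      have hquad : (L₀ + L₁ * ‖fgrad (x s)‖) * ‖m s‖ ^ 2 ≤ Ls s * M ^ 2 :=
        mul_le_mul (hKL s) (pow_le_pow_left₀ (norm_nonneg _) (hmM s) 2) (by positivity) (hLs0 s)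
      rw [hxrec s hs]
      linarith
  rw [hM2]
  refine (Finset.sum_le_sum fun t ht => hΔ (Finset.mem_Icc.1 ht).1).trans_eq ?_
  simp only [Finset.sum_add_distrib (s := Icc 1 T), Finset.sum_add_distrib (f := fun s => M * _),
    ← Finset.mul_sum, Finset.sum_const, Nat.card_Icc, nsmul_eq_mul, Nat.add_sub_cancel]
  ring
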